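/- arXiv:math/0312482 — 5 statements merged into one kernel-verified Lean document; each statement's English description precedes it below -/
import Mathlib

section
/- Let G=(V,E) be a finite simple graph on n vertices and let λ_2(G) denote the second smallest eigenvalue of its Laplacian. If λ_2(G) > k·n/(k+1) for an integer k ≥ 0, then the k-th reduced cohomology group with real coefficients of the flag complex X(G) vanishes: H̃^k(X(G);ℝ) = 0. -/
open Finset
open scoped ENNReal
/-- An ordered tuple of vertices spans a simplex of the flag complex `X(G)`
iff its entries are pairwise adjacent. -/
def SimpleGraph.IsFlagSimplex {V : Type*} (G : SimpleGraph V) {m : ℕ} (σ : Fin m → V) : Prop :=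
  ∀ i j : Fin m, i ≠ j → G.Adj (σ i) (σ j)

/-- A (real) simplicial cochain of `X(G)` in degree `m - 1`: a skew-symmetric function
on ordered `m`-tuples of vertices, supported on the ordered simplices of `X(G)`.
(For `m = 0` this is the augmented degree `-1` part, a copy of `ℝ`.) -/
def SimpleGraph.IsFlagCochain {V : Type*} (G : SimpleGraph V) {m : ℕ}
    (φ : (Fin m → V) → ℝ) : Prop :=
  (∀ σ : Fin m → V, ¬ G.IsFlagSimplex σ → φ σ = 0) ∧
  (∀ (σ : Fin m → V) (π : Equiv.Perm (Fin m)),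
    φ (σ ∘ π) = ((Equiv.Perm.sign π : ℤ) : ℝ) * φ σ)

open scoped Classical in
/-- The simplicial coboundary operator `d` of the flag complex `X(G)`:
`(dφ)(σ) = ∑ i, (-1)^i φ(σ with i-th entry removed)` for an ordered simplex `σ`. -/
noncomputable def SimpleGraph.coboundary {V : Type*} (G : SimpleGraph V) {m : ℕ}
    (φ : (Fin m → V) → ℝ) : (Fin (m + 1) → V) → ℝ :=
  fun σ =>
    if G.IsFlagSimplex σ then
      ∑ i : Fin (m + 1), (-1 : ℝ) ^ (i : ℕ) * φ (σ ∘ i.succAbove)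
    else 0
/-- Vanishing of the reduced cohomology `H̃^k(X(G); ℝ)`: every `k`-cocycle is a coboundary
(for `k = 0`, degree `-1` cochains are the constants, giving *reduced* cohomology). -/
def SimpleGraph.flagCohomologyVanishes {V : Type*} (G : SimpleGraph V) (k : ℕ) : Prop :=
  ∀ φ : (Fin (k + 1) → V) → ℝ, G.IsFlagCochain φ → G.coboundary φ = 0 →
    ∃ ψ : (Fin k → V) → ℝ, G.IsFlagCochain ψ ∧ G.coboundary ψ = φ
open scoped Classical in
/-- The eigenvalues `0 = λ_1(G) ≤ λ_2(G) ≤ ⋯ ≤ λ_n(G)` of the Laplacian matrix of `G`,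
listed in nondecreasing order (with multiplicity). -/
noncomputable def SimpleGraph.sortedLapEigenvalues {V : Type*} [Fintype V] [DecidableEq V]
    (G : SimpleGraph V) : List ℝ :=
  List.insertionSort (· ≤ ·)
    (List.ofFn (SimpleGraph.posSemidef_lapMatrix ℝ G).isHermitian.eigenvalues₀)
/-- `λ_2(G)`, the second smallest Laplacian eigenvalue (the spectral gap). -/
noncomputable def SimpleGraph.lambdaSecond {V : Type*} [Fintype V] [DecidableEq V]
    (G : SimpleGraph V) : ℝ :=
  G.sortedLapEigenvalues.getD 1 0

open scoped Matrix

section Spectral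

/-- If all eigenvalues of a real symmetric matrix but one are at least `c > 0`, then its quadratic
form is at least `c` times the squared norm on the orthogonal complement of a kernel vector. -/
theorem Matrix.IsHermitian.mul_dotProduct_le_of_mulVec_eq_zero {ι : Type*} [Fintype ι]
    [DecidableEq ι] {A : Matrix ι ι ℝ} (hA : A.IsHermitian) {c : ℝ} (hc : 0 < c) {i₀ : ι}
    (hi : ∀ i, i ≠ i₀ → c ≤ hA.eigenvalues i) {x f : ι → ℝ} (hx : x ≠ 0) (hAx : A *ᵥ x = 0)
    (hfx : f ⬝ᵥ x = 0) : c * (f ⬝ᵥ f) ≤ f ⬝ᵥ (A *ᵥ f) := by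
  set b : ι → ι → ℝ := fun i => ⇑(hA.eigenvectorBasis i) with hb
  have parseval (y z : ι → ℝ) : ∑ i, (b i ⬝ᵥ y) * (b i ⬝ᵥ z) = y ⬝ᵥ z := by
    have h := hA.eigenvectorBasis.sum_inner_mul_inner (WithLp.toLp 2 y) (WithLp.toLp 2 z)
    simpa [EuclideanSpace.inner_eq_star_dotProduct, dotProduct_comm, hb] using h
  have eigen (i : ι) (y : ι → ℝ) : b i ⬝ᵥ (A *ᵥ y) = hA.eigenvalues i * (b i ⬝ᵥ y) := by
    have hs : Aᵀ = A := by simpa [Matrix.IsHermitian] using hA.eq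
    rw [Matrix.dotProduct_mulVec, ← Matrix.mulVec_transpose, hs, hb]
    simp only [hA.mulVec_eigenvectorBasis, smul_dotProduct, smul_eq_mul]
  have hbx (i : ι) (h : i ≠ i₀) : b i ⬝ᵥ x = 0 := by
    have h1 := eigen i x
    rw [hAx, dotProduct_zero] at h1
    exact (mul_eq_zero.mp h1.symm).resolve_left (hc.trans_le (hi i h)).ne'
  have hbx₀ : b i₀ ⬝ᵥ x ≠ 0 := by
    intro h
    apply hx
    rw [← dotProduct_self_eq_zero, ← parseval]
    refine Finset.sum_eq_zero fun i _ => ?_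
    by_cases hii : i = i₀
    · rw [hii, h, zero_mul]
    · rw [hbx i hii, zero_mul]
  have hbf₀ : b i₀ ⬝ᵥ f = 0 := by
    rw [← parseval, Finset.sum_eq_single i₀ (fun i _ h => by rw [hbx i h, mul_zero])
      (by simp)] at hfx
    exact (mul_eq_zero.mp hfx).resolve_right hbx₀
  rw [← parseval f f, ← parseval f (A *ᵥ f), Finset.mul_sum]
  refine Finset.sum_le_sum fun i _ => ?_
  rw [eigen]
  by_cases hii : i = i₀
  · rw [hii, hbf₀]; simp
  · nlinarith [mul_le_mul_of_nonneg_right (hi i hii) (mul_self_nonneg (b i ⬝ᵥ f))]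

/-- All entries of an antitone family but the last one are at least the second entry
of the increasing rearrangement. -/
theorem Antitone.getD_insertionSort_ofFn_le {n : ℕ} {e : Fin n → ℝ} (he : Antitone e)
    {j : Fin n} (hj : (j : ℕ) + 1 < n) :
    ((List.ofFn e).insertionSort (· ≤ ·)).getD 1 0 ≤ e j := by
  have hl : (List.ofFn e).insertionSort (· ≤ ·) = List.ofFn (e ∘ Fin.rev) := by
    refine List.Perm.eq_of_sortedLE List.sortedLE_insertionSort
      (he.comp Fin.rev_anti).sortedLE_ofFn ((List.perm_insertionSort _ _).trans ?_)
    exact (Equiv.Perm.ofFn_comp_perm Fin.revPerm e).symm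
  rw [hl, List.getD_eq_getElem _ _ (by simp; omega), List.getElem_ofFn]
  apply he
  simp only [Fin.le_def, Fin.val_rev]
  omega

open scoped Classical in
/-- The variational characterization of the spectral gap. -/
theorem SimpleGraph.lambdaSecond_mul_sum_sq_le {V : Type*} [Fintype V] [DecidableEq V]
    (G : SimpleGraph V) (hG : 0 < G.lambdaSecond) {f : V → ℝ} (hf : ∑ v, f v = 0) :
    G.lambdaSecond * ∑ v, f v ^ 2 ≤
      ∑ v, ∑ u, if G.Adj u v then f v ^ 2 - f v * f u else 0 := by
  have hA := (SimpleGraph.posSemidef_lapMatrix ℝ G).isHermitian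
  have hcard : 1 < Fintype.card V := by
    by_contra! h
    rw [lambdaSecond, sortedLapEigenvalues, List.getD_eq_default _ _ (by simpa using h)] at hG
    exact hG.false
  have : Nonempty V := Fintype.card_pos_iff.mp (by omega)
  let eqv : Fin (Fintype.card V) ≃ V := Fintype.equivOfCardEq (Fintype.card_fin _)
  have hle (i : V) (hi : i ≠ eqv ⟨Fintype.card V - 1, by omega⟩) :
      G.lambdaSecond ≤ hA.eigenvalues i := by
    refine hA.eigenvalues₀_antitone.getD_insertionSort_ofFn_le ?_
    have h1 : eqv.symm i ≠ ⟨Fintype.card V - 1, by omega⟩ := fun h => hi (by simp [← h])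
    have h2 := (eqv.symm i).isLt
    rw [Ne, Fin.ext_iff] at h1
    change (eqv.symm i : ℕ) + 1 < _
    simp only at h1
    omega
  have h := hA.mul_dotProduct_le_of_mulVec_eq_zero hG hle (x := fun _ => 1) (f := f)
    (fun h => one_ne_zero (congrFun h (Classical.arbitrary V)))
    (lapMatrix_mulVec_const_eq_zero G) (by simpa [dotProduct] using hf)
  convert h using 1
  · simp [dotProduct, sq]
  · refine Finset.sum_congr rfl fun v _ => ?_
    rw [lapMatrix_mulVec_apply, degree_eq_sum_if_adj, mul_sub, Finset.sum_mul,
      Finset.mul_sum, Finset.mul_sum, neighborFinset_eq_filter, Finset.sum_filter,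
      ← Finset.sum_sub_distrib]
    refine Finset.sum_congr rfl fun u _ => ?_
    by_cases huv : G.Adj u v
    · simp [huv, huv.symm, sq]
    · simp [huv, G.adj_comm v u]

end Spectral

/-- Orthogonal decomposition of a real function along a subspace of functions. -/
theorem Submodule.exists_mem_forall_dotProduct_sub_eq_zero {ι : Type*} [Fintype ι]
    (W : Submodule ℝ (ι → ℝ)) (φ : ι → ℝ) : ∃ w ∈ W, ∀ u ∈ W, (φ - w) ⬝ᵥ u = 0 := by
  let e := WithLp.linearEquiv 2 ℝ (ι → ℝ)
  obtain ⟨y, hy, z, hz, h⟩ :=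
    (W.comap e.toLinearMap).exists_add_mem_mem_orthogonal (WithLp.toLp 2 φ)
  refine ⟨e y, hy, fun u hu => ?_⟩
  have h1 := hz (WithLp.toLp 2 u) (by simpa [e] using hu)
  have h2 : φ - e y = e z := by
    have := congrArg e h
    rw [map_add] at this
    rw [sub_eq_iff_eq_add', ← this]
    rfl
  rw [h2]
  simpa [EuclideanSpace.inner_eq_star_dotProduct, dotProduct_comm, e] using h1

/-- Deleting the `i`-th entry after a permutation `π` amounts to deleting the entry `π i` and
permuting the remaining ones. -/
theorem Equiv.Perm.exists_comp_succAbove {m : ℕ} (π : Equiv.Perm (Fin (m + 1)))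
    (i : Fin (m + 1)) : ∃ ρ : Equiv.Perm (Fin m),
      (∀ j, π (i.succAbove j) = (π i).succAbove (ρ j)) ∧
      (-1 : ℝ) ^ (i : ℕ) * ((sign ρ : ℤ) : ℝ) =
        ((sign π : ℤ) : ℝ) * (-1) ^ (π i : ℕ) := by
  set τ : Equiv.Perm (Fin (m + 1)) := (π i).cycleRange * π * i.cycleRange⁻¹ with hτ
  obtain ⟨⟨p, ρ⟩, hρ⟩ := Equiv.Perm.decomposeFin.symm.surjective τ
  have hinv : (i.cycleRange⁻¹ : Equiv.Perm (Fin (m + 1))) = i.cycleRange.symm := rfl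
  have hp : p = 0 := by
    have : τ 0 = 0 := by simp [hτ, hinv]
    rw [← hρ] at this
    simpa using this
  subst hp
  refine ⟨ρ, fun j => ?_, ?_⟩
  · have h1 : τ j.succ = (ρ j).succ := by rw [← hρ]; simp
    have h2 : τ j.succ = (π i).cycleRange (π (i.succAbove j)) := by simp [hτ, hinv]
    rw [← Fin.cycleRange_symm_succ (π i), ← h1, h2, Equiv.symm_apply_apply]
  · have h1 : sign τ = sign ρ := by rw [← hρ]; simp [Equiv.Perm.decomposeFin.symm_sign]
    rw [← h1, hτ]
    simp only [sign_mul, sign_inv, Fin.sign_cycleRange]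
    push_cast
    have h2 : ((-1 : ℝ) ^ (i : ℕ)) * (-1) ^ (i : ℕ) = 1 := by
      rw [← mul_pow]; simp
    linear_combination (((sign π : ℤ) : ℝ) * (-1) ^ (π i : ℕ)) * h2

theorem Fin.sum_eq_sum_sum_insertNth {V : Type*} [Fintype V] {m : ℕ}
    (F : (Fin (m + 1) → V) → ℝ) (i : Fin (m + 1)) :
    ∑ σ, F σ = ∑ v, ∑ τ, F (i.insertNth v τ) := by
  rw [← Fintype.sum_prod_type']
  exact (Fintype.sum_equiv (Fin.insertNthEquiv (fun _ => V) i) _ _ fun _ => rfl).symm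

namespace SimpleGraph

variable {V : Type*} {G : SimpleGraph V} {m : ℕ}

theorem IsFlagSimplex.comp_injective {l : ℕ} {σ : Fin m → V} (hσ : G.IsFlagSimplex σ)
    {g : Fin l → Fin m} (hg : Function.Injective g) : G.IsFlagSimplex (σ ∘ g) :=
  fun _ _ hij => hσ _ _ (hg.ne hij)

theorem isFlagSimplex_comp_perm {σ : Fin m → V} (π : Equiv.Perm (Fin m)) :
    G.IsFlagSimplex (σ ∘ π) ↔ G.IsFlagSimplex σ := by
  refine ⟨fun h => ?_, fun h => h.comp_injective π.injective⟩
  simpa [Function.comp_assoc] using h.comp_injective π.symm.injective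

theorem isFlagSimplex_cons {v : V} {σ : Fin m → V} :
    G.IsFlagSimplex (Fin.cons v σ : Fin (m + 1) → V) ↔
      (∀ i, G.Adj v (σ i)) ∧ G.IsFlagSimplex σ := by
  simp only [IsFlagSimplex, Fin.forall_fin_succ, Fin.cons_zero, Fin.cons_succ]
  constructor
  · rintro ⟨⟨-, h1⟩, h2⟩
    exact ⟨fun i => h1 i (Fin.succ_ne_zero i).symm,
      fun i j hij => (h2 i).2 j (by simpa using hij)⟩
  · rintro ⟨h1, h2⟩
    exact ⟨⟨fun h => absurd rfl h, fun i _ => h1 i⟩, fun i => ⟨fun _ => (h1 i).symm,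
      fun j hij => h2 i j (by simpa using hij)⟩⟩

theorem IsFlagCochain.apply_insertNth {φ : (Fin (m + 1) → V) → ℝ} (hφ : G.IsFlagCochain φ)
    (i : Fin (m + 1)) (v : V) (τ : Fin m → V) :
    φ (i.insertNth v τ) = (-1) ^ (i : ℕ) * φ (Fin.cons v τ) := by
  rw [← Fin.cons_comp_cycleRange, hφ.2, Fin.sign_cycleRange]
  simp

theorem IsFlagCochain.apply_cons_eq_zero {φ : (Fin (m + 1) → V) → ℝ} (hφ : G.IsFlagCochain φ)
    {v : V} {τ : Fin m → V} (h : ¬ ∀ i, G.Adj v (τ i)) : φ (Fin.cons v τ) = 0 :=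
  hφ.1 _ fun hs => h (isFlagSimplex_cons.mp hs).1

theorem coboundary_of_isFlagSimplex (φ : (Fin m → V) → ℝ) {σ : Fin (m + 1) → V}
    (hσ : G.IsFlagSimplex σ) :
    G.coboundary φ σ = ∑ i : Fin (m + 1), (-1 : ℝ) ^ (i : ℕ) * φ (σ ∘ i.succAbove) :=
  if_pos hσ

theorem coboundary_of_not_isFlagSimplex (φ : (Fin m → V) → ℝ) {σ : Fin (m + 1) → V}
    (hσ : ¬ G.IsFlagSimplex σ) : G.coboundary φ σ = 0 :=
  if_neg hσ

theorem coboundary_add (φ ψ : (Fin m → V) → ℝ) :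
    G.coboundary (φ + ψ) = G.coboundary φ + G.coboundary ψ := by
  ext σ
  by_cases hσ : G.IsFlagSimplex σ
  · simp [coboundary_of_isFlagSimplex _ hσ, mul_add, Finset.sum_add_distrib]
  · simp [coboundary_of_not_isFlagSimplex _ hσ]

theorem coboundary_smul (c : ℝ) (φ : (Fin m → V) → ℝ) :
    G.coboundary (c • φ) = c • G.coboundary φ := by
  ext σ
  by_cases hσ : G.IsFlagSimplex σ
  · simp [coboundary_of_isFlagSimplex _ hσ, Finset.mul_sum, mul_left_comm]
  · simp [coboundary_of_not_isFlagSimplex _ hσ]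

theorem IsFlagCochain.coboundary {φ : (Fin m → V) → ℝ} (hφ : G.IsFlagCochain φ) :
    G.IsFlagCochain (G.coboundary φ) := by
  refine ⟨fun σ hσ => coboundary_of_not_isFlagSimplex _ hσ, fun σ π => ?_⟩
  by_cases hσ : G.IsFlagSimplex σ
  · rw [coboundary_of_isFlagSimplex _ hσ,
      coboundary_of_isFlagSimplex _ ((isFlagSimplex_comp_perm π).mpr hσ),
      ← Equiv.sum_comp π fun i => (-1 : ℝ) ^ (i : ℕ) * φ (σ ∘ i.succAbove), Finset.mul_sum]
    refine Finset.sum_congr rfl fun i _ => ?_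
    obtain ⟨ρ, h1, h2⟩ := π.exists_comp_succAbove i
    have h3 : (σ ∘ π) ∘ i.succAbove = (σ ∘ (π i).succAbove) ∘ ρ := by
      ext j
      simp [h1]
    rw [h3, hφ.2, ← mul_assoc, h2, mul_assoc]
  · rw [coboundary_of_not_isFlagSimplex _ hσ,
      coboundary_of_not_isFlagSimplex _ (mt (isFlagSimplex_comp_perm π).mp hσ), mul_zero]

theorem coboundary_coboundary (φ : (Fin m → V) → ℝ) : G.coboundary (G.coboundary φ) = 0 := by
  ext σ
  by_cases hσ : G.IsFlagSimplex σ
  · simp only [coboundary_of_isFlagSimplex _ hσ, Pi.zero_apply,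
      coboundary_of_isFlagSimplex _ (hσ.comp_injective Fin.succAbove_right_injective),
      Finset.mul_sum]
    rw [← Fintype.sum_prod_type']
    refine Finset.sum_ninvolution
      (fun p => (p.1.succAbove p.2, p.2.predAbove p.1)) (fun p => ?_) (fun p _ h => ?_)
      (fun p => Finset.mem_univ _) (fun p => ?_)
    · have h : ((σ ∘ (p.1.succAbove p.2).succAbove) ∘ (p.2.predAbove p.1).succAbove) =
          (σ ∘ p.1.succAbove) ∘ p.2.succAbove := by
        ext j
        simp [Fin.succAbove_succAbove_succAbove_predAbove]
      simp only [h]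
      have h2 := Fin.neg_one_pow_succAbove_add_predAbove (R := ℝ) p.1 p.2
      rw [pow_add, pow_add] at h2
      linear_combination (φ ((σ ∘ p.1.succAbove) ∘ p.2.succAbove)) * h2
    · exact Fin.succAbove_ne _ _ (congrArg Prod.fst h)
    · ext1
      · exact Fin.succAbove_succAbove_predAbove _ _
      · exact Fin.predAbove_predAbove_succAbove _ _
  · exact coboundary_of_not_isFlagSimplex _ hσ

variable (G) in
/-- The space of coboundaries of flag cochains. -/
noncomputable def flagCoboundaries (m : ℕ) : Submodule ℝ ((Fin (m + 1) → V) → ℝ) where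
  carrier := {w | ∃ ψ : (Fin m → V) → ℝ, G.IsFlagCochain ψ ∧ G.coboundary ψ = w}
  add_mem' := by
    rintro _ _ ⟨ψ, hψ, rfl⟩ ⟨χ, hχ, rfl⟩
    refine ⟨ψ + χ, ⟨fun σ hσ => ?_, fun σ π => ?_⟩, coboundary_add ψ χ⟩
    · simp [hψ.1 σ hσ, hχ.1 σ hσ]
    · simp [hψ.2 σ π, hχ.2 σ π, mul_add]
  zero_mem' := ⟨0, by simp [IsFlagCochain], by simpa using coboundary_smul (G := G) 0 0⟩
  smul_mem' := by
    rintro c _ ⟨ψ, hψ, rfl⟩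
    refine ⟨c • ψ, ⟨fun σ hσ => ?_, fun σ π => ?_⟩, coboundary_smul c ψ⟩
    · simp [hψ.1 σ hσ]
    · simp [hψ.2 σ π, mul_left_comm]

open scoped Classical in
theorem sum_adj_le (σ : Fin (m + 1) → V) (u : V) {c : ℝ} (hc : 0 ≤ c) :
    ∑ i, (if G.Adj u (σ i) then c else 0) ≤ m * c + if ∀ i, G.Adj u (σ i) then c else 0 := by
  split_ifs with h
  · simp [h, add_mul]
  · obtain ⟨j, hj⟩ := not_forall.mp h
    rw [Fin.sum_univ_succAbove _ j, if_neg hj, zero_add, add_zero]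
    refine (Finset.sum_le_sum (g := fun _ => c) fun i _ => ?_).trans (by simp)
    split_ifs <;> simp [hc]

section Fintype

variable [Fintype V]

theorem IsFlagCochain.sum_cons {φ : (Fin (m + 1) → V) → ℝ} (hφ : G.IsFlagCochain φ) :
    G.IsFlagCochain fun τ : Fin m → V => ∑ v, φ (Fin.cons v τ) := by
  refine ⟨fun τ hτ => Finset.sum_eq_zero fun v _ =>
    hφ.1 _ fun h => hτ (isFlagSimplex_cons.mp h).2, fun τ π => ?_⟩
  rw [Finset.mul_sum]
  refine Finset.sum_congr rfl fun v _ => ?_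
  have h : (Fin.cons v (τ ∘ π) : Fin (m + 1) → V) =
      Fin.cons v τ ∘ Equiv.Perm.decomposeFin.symm (0, π) := by
    ext j
    refine Fin.cases ?_ (fun j => ?_) j <;> simp
  rw [h, hφ.2, Equiv.Perm.decomposeFin.symm_sign]
  simp

/-- On cochains, the adjoint of the coboundary is, up to a factor, summation over the first
entry. -/
theorem IsFlagCochain.dotProduct_coboundary {φ : (Fin (m + 1) → V) → ℝ}
    (hφ : G.IsFlagCochain φ) (ψ : (Fin m → V) → ℝ) :
    φ ⬝ᵥ G.coboundary ψ = (m + 1) * ∑ τ, (∑ v, φ (Fin.cons v τ)) * ψ τ := by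
  have h (σ : Fin (m + 1) → V) : φ σ * G.coboundary ψ σ =
      ∑ i : Fin (m + 1), φ σ * ((-1) ^ (i : ℕ) * ψ (σ ∘ i.succAbove)) := by
    by_cases hσ : G.IsFlagSimplex σ
    · rw [coboundary_of_isFlagSimplex _ hσ, Finset.mul_sum]
    · simp [hφ.1 σ hσ]
  have h2 (i : Fin (m + 1)) :
      ∑ σ, φ σ * ((-1) ^ (i : ℕ) * ψ (σ ∘ i.succAbove)) =
        ∑ τ, (∑ v, φ (Fin.cons v τ)) * ψ τ := by
    rw [Fin.sum_eq_sum_sum_insertNth _ i, Finset.sum_comm]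
    refine Finset.sum_congr rfl fun τ _ => ?_
    rw [Finset.sum_mul]
    refine Finset.sum_congr rfl fun v _ => ?_
    have h3 : (i.insertNth v τ : Fin (m + 1) → V) ∘ i.succAbove = τ := by
      ext j; simp
    have h4 : ((-1 : ℝ) ^ (i : ℕ)) * (-1) ^ (i : ℕ) = 1 := by
      rw [← mul_pow]; simp
    rw [hφ.apply_insertNth, h3]
    linear_combination (φ (Fin.cons v τ) * ψ τ) * h4
  simp_rw [dotProduct, h]
  rw [Finset.sum_comm]
  simp_rw [h2]
  simp

open scoped Classical in
/-- The cocycle identity, paired with the cocycle itself. -/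
theorem IsFlagCochain.sum_adj_mul_sq {φ : (Fin (m + 1) → V) → ℝ} (hφ : G.IsFlagCochain φ)
    (hd : G.coboundary φ = 0) :
    ∑ σ, ∑ u, (if ∀ i, G.Adj u (σ i) then φ σ ^ 2 else 0) =
      (m + 1) * ∑ τ : Fin m → V, ∑ v, ∑ u,
        if G.Adj u v then φ (Fin.cons v τ) * φ (Fin.cons u τ) else 0 := by
  have h (σ : Fin (m + 1) → V) (u : V) : (if ∀ i, G.Adj u (σ i) then φ σ ^ 2 else 0) =
      ∑ i : Fin (m + 1), if ∀ j, G.Adj u (σ j) then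
        φ σ * ((-1) ^ (i : ℕ) * φ (Fin.cons u (i.removeNth σ))) else 0 := by
    split_ifs with hu
    · by_cases hσ : G.IsFlagSimplex σ
      · have h1 := congrFun hd (Fin.cons u σ)
        rw [coboundary_of_isFlagSimplex _ (isFlagSimplex_cons.mpr ⟨hu, hσ⟩),
          Fin.sum_univ_succ] at h1
        have h2 : (Fin.cons u σ : Fin (m + 2) → V) ∘ Fin.succ = σ := by ext j; simp
        simp only [Fin.val_zero, pow_zero, one_mul, Fin.succAbove_zero, Fin.val_succ, pow_succ,
          Fin.cons_comp_succ_succAbove, Pi.zero_apply, h2, mul_neg, mul_one, neg_mul,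
          Finset.sum_neg_distrib] at h1
        rw [← Finset.mul_sum]
        linear_combination φ σ * h1
      · simp [hφ.1 σ hσ]
    · simp
  have h2 (i : Fin (m + 1)) : ∑ σ : Fin (m + 1) → V, ∑ u, (if ∀ j, G.Adj u (σ j) then
        φ σ * ((-1) ^ (i : ℕ) * φ (Fin.cons u (i.removeNth σ))) else 0) =
      ∑ τ : Fin m → V, ∑ v, ∑ u,
        if G.Adj u v then φ (Fin.cons v τ) * φ (Fin.cons u τ) else 0 := by
    rw [Fin.sum_eq_sum_sum_insertNth _ i, Finset.sum_comm]
    refine Finset.sum_congr rfl fun τ _ => Finset.sum_congr rfl fun v _ =>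
      Finset.sum_congr rfl fun u _ => ?_
    have h4 : ((-1 : ℝ) ^ (i : ℕ)) * (-1) ^ (i : ℕ) = 1 := by
      rw [← mul_pow]; simp
    simp only [Fin.forall_iff_succAbove i, Fin.insertNth_apply_same,
      Fin.insertNth_apply_succAbove, Fin.removeNth_insertNth, hφ.apply_insertNth]
    by_cases huv : G.Adj u v
    · by_cases hu : ∀ j, G.Adj u (τ j)
      · rw [if_pos ⟨huv, hu⟩, if_pos huv]
        linear_combination (φ (Fin.cons v τ) * φ (Fin.cons u τ)) * h4
      · simp [hφ.apply_cons_eq_zero hu]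
    · simp [huv]
  simp_rw [h]
  have h5 (σ : Fin (m + 1) → V) : ∑ u, ∑ i : Fin (m + 1), (if ∀ j, G.Adj u (σ j) then
        φ σ * ((-1) ^ (i : ℕ) * φ (Fin.cons u (i.removeNth σ))) else 0) =
      ∑ i : Fin (m + 1), ∑ u, (if ∀ j, G.Adj u (σ j) then
        φ σ * ((-1) ^ (i : ℕ) * φ (Fin.cons u (i.removeNth σ))) else 0) := Finset.sum_comm
  simp_rw [h5]
  rw [Finset.sum_comm]
  simp_rw [h2]
  simp

open scoped Classical in
theorem IsFlagCochain.sum_sum_degree_mul_sq {φ : (Fin (m + 1) → V) → ℝ}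
    (hφ : G.IsFlagCochain φ) :
    ∑ σ, ∑ u, ∑ i, (if G.Adj u (σ i) then φ σ ^ 2 else 0) =
      (m + 1) * ∑ τ : Fin m → V, ∑ v, ∑ u,
        if G.Adj u v then φ (Fin.cons v τ) ^ 2 else 0 := by
  have h2 (i : Fin (m + 1)) :
      ∑ σ, ∑ u, (if G.Adj u (σ i) then φ σ ^ 2 else 0) =
        ∑ τ : Fin m → V, ∑ v, ∑ u, if G.Adj u v then φ (Fin.cons v τ) ^ 2 else 0 := by
    rw [Fin.sum_eq_sum_sum_insertNth _ i, Finset.sum_comm]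
    simp [hφ.apply_insertNth, mul_pow, pow_right_comm _ _ 2]
  have h5 (σ : Fin (m + 1) → V) : ∑ u, ∑ i, (if G.Adj u (σ i) then φ σ ^ 2 else 0) =
      ∑ i, ∑ u, if G.Adj u (σ i) then φ σ ^ 2 else 0 := Finset.sum_comm
  simp_rw [h5]
  rw [Finset.sum_comm]
  simp_rw [h2]
  simp

/-- A harmonic cochain vanishes if the spectral gap is large. -/
theorem IsFlagCochain.eq_zero_of_lambdaSecond [DecidableEq V] {k : ℕ}
    (h : G.lambdaSecond > (k : ℝ) * (Fintype.card V : ℝ) / ((k : ℝ) + 1))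
    {φ : (Fin (k + 1) → V) → ℝ} (hφ : G.IsFlagCochain φ) (hd : G.coboundary φ = 0)
    (hs : ∀ τ : Fin k → V, ∑ v, φ (Fin.cons v τ) = 0) : φ = 0 := by
  classical
  have hpos : 0 < G.lambdaSecond := lt_of_le_of_lt (by positivity) h
  have hgap : ∑ τ : Fin k → V, G.lambdaSecond * ∑ v, φ (Fin.cons v τ) ^ 2 ≤
      ∑ τ : Fin k → V, ∑ v, ∑ u, if G.Adj u v then
        φ (Fin.cons v τ) ^ 2 - φ (Fin.cons v τ) * φ (Fin.cons u τ) else 0 :=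
    Finset.sum_le_sum fun τ _ => G.lambdaSecond_mul_sum_sq_le hpos (hs τ)
  have hN : ∑ σ, φ σ ^ 2 = ∑ τ : Fin k → V, ∑ v, φ (Fin.cons v τ) ^ 2 := by
    rw [Fin.sum_eq_sum_sum_insertNth _ 0, Finset.sum_comm]
    simp [Fin.insertNth_zero']
  rw [← Finset.mul_sum, ← hN] at hgap
  have hsub (τ : Fin k → V) (v u : V) : (if G.Adj u v then
        φ (Fin.cons v τ) ^ 2 - φ (Fin.cons v τ) * φ (Fin.cons u τ) else 0) =
      (if G.Adj u v then φ (Fin.cons v τ) ^ 2 else 0) -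
        if G.Adj u v then φ (Fin.cons v τ) * φ (Fin.cons u τ) else 0 := by
    split_ifs <;> simp
  simp_rw [hsub, Finset.sum_sub_distrib] at hgap
  have hdeg : ∑ σ, ∑ u, ∑ i, (if G.Adj u (σ i) then φ σ ^ 2 else 0) ≤
      ∑ σ : Fin (k + 1) → V, ∑ u : V,
        (k * φ σ ^ 2 + if ∀ i, G.Adj u (σ i) then φ σ ^ 2 else 0) :=
    Finset.sum_le_sum fun σ _ => Finset.sum_le_sum fun u _ => sum_adj_le σ u (sq_nonneg _)
  simp_rw [Finset.sum_add_distrib] at hdeg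
  rw [hφ.sum_sum_degree_mul_sq, hφ.sum_adj_mul_sq hd] at hdeg
  simp only [Finset.sum_const, Finset.card_univ, nsmul_eq_mul, ← Finset.mul_sum] at hdeg
  have hk : (0 : ℝ) < k + 1 := by positivity
  rw [gt_iff_lt, div_lt_iff₀ hk] at h
  have hN0 : ∑ σ, φ σ ^ 2 = 0 := by
    refine le_antisymm ?_ (Finset.sum_nonneg fun σ _ => sq_nonneg _)
    by_contra! hlt
    nlinarith [mul_le_mul_of_nonneg_left hgap hk.le, mul_lt_mul_of_pos_right h hlt]
  ext σ
  exact pow_eq_zero_iff two_ne_zero |>.mp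
    ((Finset.sum_eq_zero_iff_of_nonneg fun σ _ => sq_nonneg (φ σ)).mp hN0 σ (Finset.mem_univ σ))

end Fintype

end SimpleGraph

/-- **Theorem 1.2** (Aharoni–Berger–Meshulam): if the spectral gap of a graph `G` on `n`
vertices satisfies `λ_2(G) > k·n/(k+1)`, then `H̃^k(X(G); ℝ) = 0`. -/
theorem flag_cohomology_vanishes_of_lambdaSecond {V : Type*} [Fintype V] [DecidableEq V]
    (G : SimpleGraph V) (k : ℕ)
    (h : G.lambdaSecond > (k : ℝ) * (Fintype.card V : ℝ) / ((k : ℝ) + 1)) :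
    G.flagCohomologyVanishes k := by
  intro φ hφ hd
  obtain ⟨_, ⟨ψ, hψ, rfl⟩, horth⟩ :=
    (G.flagCoboundaries k).exists_mem_forall_dotProduct_sub_eq_zero φ
  refine ⟨ψ, hψ, ?_⟩
  have hcochain : G.IsFlagCochain (φ - G.coboundary ψ) := by
    refine ⟨fun σ hσ => ?_, fun σ π => ?_⟩
    · simp [hφ.1 σ hσ, hψ.coboundary.1 σ hσ]
    · simp [hφ.2 σ π, hψ.coboundary.2 σ π, mul_sub]
  have hcocycle : G.coboundary (φ - G.coboundary ψ) = 0 := by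
    have : φ - G.coboundary ψ = φ + (-1 : ℝ) • G.coboundary ψ := by simp [sub_eq_add_neg]
    rw [this, SimpleGraph.coboundary_add, SimpleGraph.coboundary_smul, hd,
      SimpleGraph.coboundary_coboundary]
    simp
  have hsum : ∑ τ : Fin k → V, (∑ v, (φ - G.coboundary ψ) (Fin.cons v τ)) *
      (∑ v, (φ - G.coboundary ψ) (Fin.cons v τ)) = 0 := by
    have h1 := horth _ ⟨_, hcochain.sum_cons, rfl⟩
    rw [hcochain.dotProduct_coboundary] at h1
    exact (mul_eq_zero.mp h1).resolve_left (by positivity)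
  refine (sub_eq_zero.mp (hcochain.eq_zero_of_lambdaSecond h hcocycle fun τ => ?_)).symm
  exact mul_self_eq_zero.mp ((Finset.sum_eq_zero_iff_of_nonneg fun τ _ =>
    mul_self_nonneg _).mp hsum τ (Finset.mem_univ τ))
end

section
/- Let n = rℓ with r ≥ 1 and ℓ ≥ 2, and let T_r(n) be the Turán graph, i.e. the complete r-partite graph on n vertices with all r parts of size ℓ. Then for all 0 ≤ k ≤ r−1, the minimal eigenvalue of the reduced k-Laplacian of the flag complex X(T_r(n)) equals μ_k(T_r(n)) = ℓ(r−k−1). -/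
open Finset
open scoped ENNReal
/-- The adjoint `d*` of the coboundary operator (with respect to the standard inner
products on cochains): `(d*φ)(τ) = ∑_{v ∈ lk(τ)} φ(vτ)`. -/
noncomputable def SimpleGraph.coboundaryAdj {V : Type*} [Fintype V] (G : SimpleGraph V) {m : ℕ}
    (φ : (Fin (m + 1) → V) → ℝ) : (Fin m → V) → ℝ :=
  fun τ => ∑ v : V, φ (Fin.cons v τ)
/-- The reduced `k`-dimensional Laplacian `Δ_k = d_{k-1} d_{k-1}* + d_k* d_k`
of the flag complex `X(G)`, acting on `k`-cochains. -/
noncomputable def SimpleGraph.flagLaplacian {V : Type*} [Fintype V] (G : SimpleGraph V) {k : ℕ}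
    (φ : (Fin (k + 1) → V) → ℝ) : (Fin (k + 1) → V) → ℝ :=
  fun σ => G.coboundary (G.coboundaryAdj φ) σ + G.coboundaryAdj (G.coboundary φ) σ
/-- `μ_k(G)`: the minimal eigenvalue of the reduced `k`-Laplacian of `X(G)`. -/
noncomputable def SimpleGraph.flagMu {V : Type*} [Fintype V] [DecidableEq V]
    (G : SimpleGraph V) (k : ℕ) : ℝ :=
  sInf {μ : ℝ | ∃ φ : (Fin (k + 1) → V) → ℝ,
    G.IsFlagCochain φ ∧ φ ≠ 0 ∧ G.flagLaplacian φ = μ • φ}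

namespace SimpleGraph

variable {V κ : Type*} {G : SimpleGraph V} {c : V → κ}

/-- A tuple of vertices of a complete multipartite graph spans a simplex iff its entries
lie in distinct parts. -/
lemma isFlagSimplex_iff_injective (hG : ∀ v w, G.Adj v w ↔ c v ≠ c w) {m : ℕ} (σ : Fin m → V) :
    G.IsFlagSimplex σ ↔ Function.Injective (c ∘ σ) := by
  simp only [IsFlagSimplex, hG, Function.Injective, Function.comp_apply]
  exact forall₂_congr fun i j => by rw [ne_eq, not_imp_not]

lemma comp_update_of_eq {m : ℕ} {σ : Fin m → V} {i : Fin m} {v : V} (h : c v = c (σ i)) :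
    c ∘ Function.update σ i v = c ∘ σ := by
  rw [Function.comp_update, h]
  exact Function.update_eq_self i (c ∘ σ)

/-- Moving the first vertex of an ordered simplex to the `i`-th place multiplies a cochain
by `(-1) ^ i`. -/
lemma IsFlagCochain.apply_cons_comp_succAbove {k : ℕ} {φ : (Fin (k + 1) → V) → ℝ}
    (hφ : G.IsFlagCochain φ) (σ : Fin (k + 1) → V) (i : Fin (k + 1)) (v : V) :
    (-1 : ℝ) ^ (i : ℕ) * φ (Fin.cons v (σ ∘ i.succAbove)) = φ (Function.update σ i v) := by
  have h := Fin.insertNth_comp_cycleRange_symm i v (σ ∘ i.succAbove)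
  have h2 : (i.insertNth v (σ ∘ i.succAbove) : Fin (k + 1) → V) = Function.update σ i v := by
    rw [← Fin.insertNth_removeNth]; rfl
  rw [h2] at h
  rw [← h, hφ.2, Equiv.Perm.sign_symm, Fin.sign_cycleRange]
  push_cast
  rw [← mul_assoc, ← mul_pow]
  simp

variable [Fintype V] [DecidableEq κ]

lemma flagLaplacian_apply_of_isFlagSimplex (hG : ∀ v w, G.Adj v w ↔ c v ≠ c w) {k : ℕ}
    {φ : (Fin (k + 1) → V) → ℝ} (hφ : G.IsFlagCochain φ) {σ : Fin (k + 1) → V}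
    (hσ : G.IsFlagSimplex σ) :
    G.flagLaplacian φ σ = (#{v : V | ∀ i, c v ≠ c (σ i)} : ℝ) * φ σ +
      ∑ i, ∑ v with c v = c (σ i), φ (Function.update σ i v) := by
  classical
  have hcons (v : V) : G.IsFlagSimplex (Fin.cons v σ : Fin (k + 2) → V) ↔
      ∀ i, c v ≠ c (σ i) := by
    constructor
    · intro h i
      have := h 0 i.succ (Fin.succ_ne_zero i).symm
      simpa [hG] using this
    · intro h i j hij
      cases i using Fin.cases with
      | zero =>
        cases j using Fin.cases with
        | zero => exact absurd rfl hij
        | succ j => simpa [hG] using h j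
      | succ i =>
        cases j using Fin.cases with
        | zero => simpa [hG] using (h i).symm
        | succ j => simpa using hσ i j (fun e => hij (by rw [e]))
  have hface (v : V) (i : Fin (k + 1)) :
      (Fin.cons v σ : Fin (k + 2) → V) ∘ i.succ.succAbove =
        (Fin.cons v (σ ∘ i.succAbove) : Fin (k + 1) → V) := by
    ext j
    cases j using Fin.cases <;> simp
  have hdown : G.coboundary (G.coboundaryAdj φ) σ =
      ∑ v, ∑ i, φ (Function.update σ i v) := by
    simp only [coboundary, coboundaryAdj, if_pos hσ, Finset.mul_sum,
      hφ.apply_cons_comp_succAbove]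
    exact Finset.sum_comm
  have hup : G.coboundaryAdj (G.coboundary φ) σ =
      ∑ v, if ∀ i, c v ≠ c (σ i) then φ σ - ∑ i, φ (Function.update σ i v) else 0 := by
    unfold coboundaryAdj coboundary
    refine Finset.sum_congr rfl fun v _ => ?_
    simp only [hcons]
    refine if_congr Iff.rfl ?_ rfl
    rw [Fin.sum_univ_succ, sub_eq_add_neg, ← Finset.sum_neg_distrib]
    congr 1
    · simp only [Fin.val_zero, pow_zero, one_mul]
      congr 1
    · refine Finset.sum_congr rfl fun i _ => ?_
      rw [hface, Fin.val_succ, pow_succ, ← hφ.apply_cons_comp_succAbove]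
      ring
  have hcard : (#{v : V | ∀ i, c v ≠ c (σ i)} : ℝ) * φ σ =
      ∑ v, if ∀ i, c v ≠ c (σ i) then φ σ else 0 := by
    rw [← Finset.sum_filter, Finset.sum_const, nsmul_eq_mul]
  simp only [Finset.sum_filter]
  rw [flagLaplacian, hdown, hup, hcard, Finset.sum_comm (s := (univ : Finset (Fin (k + 1)))),
    ← Finset.sum_add_distrib, ← Finset.sum_add_distrib]
  refine Finset.sum_congr rfl fun v _ => ?_
  by_cases h : ∀ i, c v ≠ c (σ i)
  · simp [h]
  · rw [if_neg h, if_neg h, add_zero, zero_add]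
    refine Finset.sum_congr rfl fun i _ => ?_
    split_ifs with hi
    · rfl
    · push Not at h
      obtain ⟨j, hj⟩ := h
      have hji : j ≠ i := by rintro rfl; exact hi hj
      refine hφ.1 _ fun hs => ?_
      have := hs i j hji.symm
      rw [hG] at this
      simp [Function.update_of_ne hji, hj] at this

lemma exists_sum_eq_zero_and_ne_zero (hc : ∀ q, 2 ≤ #{v : V | c v = q}) :
    ∃ f : V → ℝ, (∀ q, ∑ v with c v = q, f v = 0) ∧ ∀ q, ∃ v, c v = q ∧ f v ≠ 0 := by
  classical
  have h (q : κ) : ∃ a b, c a = q ∧ c b = q ∧ a ≠ b := by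
    obtain ⟨a, ha, b, hb, hab⟩ := Finset.one_lt_card.1 (hc q)
    exact ⟨a, b, (Finset.mem_filter.1 ha).2, (Finset.mem_filter.1 hb).2, hab⟩
  choose a b ha hb hab using h
  refine ⟨fun v => (if v = a (c v) then 1 else 0) - if v = b (c v) then 1 else 0,
    fun q => ?_, fun q => ⟨a q, ha q, ?_⟩⟩
  · have hsum : ∀ u : κ → V, c (u q) = q →
        ∑ v with c v = q, (if v = u (c v) then (1 : ℝ) else 0) = 1 := by
      intro u hu
      rw [Finset.sum_eq_single (u q)]
      · simp [hu]
      · intro v hv hne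
        rw [(Finset.mem_filter.1 hv).2, if_neg hne]
      · simp [hu]
    rw [Finset.sum_sub_distrib, hsum a (ha q), hsum b (hb q), sub_self]
  · simp [ha, hab]

variable [Fintype κ]

lemma card_filter_forall_ne {ℓ : ℕ} (hc : ∀ q, #{v : V | c v = q} = ℓ) {m : ℕ} {σ : Fin m → V}
    (hσ : Function.Injective (c ∘ σ)) :
    (#{v : V | ∀ i, c v ≠ c (σ i)} : ℝ) = ℓ * ((Fintype.card κ : ℝ) - m) := by
  classical
  set S : Finset κ := (univ.image (c ∘ σ))ᶜ with hS
  have hmem (v : V) : (∀ i, c v ≠ c (σ i)) ↔ c v ∈ S := by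
    simp [hS, eq_comm]
  have hScard : (#S : ℝ) = (Fintype.card κ : ℝ) - m := by
    have h := Finset.card_compl_add_card (univ.image (c ∘ σ))
    rw [Finset.card_image_of_injective _ hσ, Finset.card_univ, Fintype.card_fin, ← hS] at h
    rw [← h]
    simp
  have h1 : #{v : V | ∀ i, c v ≠ c (σ i)} = ∑ q ∈ S, ℓ := by
    rw [Finset.card_eq_sum_card_fiberwise (f := c) (t := S)]
    · refine Finset.sum_congr rfl fun q hq => ?_
      rw [← hc q, Finset.filter_filter]
      congr 1
      ext v
      simp only [Finset.mem_filter, Finset.mem_univ, true_and, hmem]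
      exact ⟨fun h => h.2, fun h => ⟨h ▸ hq, h⟩⟩
    · intro v hv
      simpa [hmem] using hv
  rw [h1, Finset.sum_const, smul_eq_mul, Nat.cast_mul, hScard]
  ring

/-- The Laplacian of a complete multipartite graph with parts of size `ℓ` is a scalar plus a sum
of operators that sum over one part in one coordinate. -/
lemma flagLaplacian_apply {ℓ : ℕ} (hG : ∀ v w, G.Adj v w ↔ c v ≠ c w)
    (hc : ∀ q, #{v : V | c v = q} = ℓ) {k : ℕ}
    {φ : (Fin (k + 1) → V) → ℝ} (hφ : G.IsFlagCochain φ) (σ : Fin (k + 1) → V) :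
    G.flagLaplacian φ σ = ℓ * ((Fintype.card κ : ℝ) - k - 1) * φ σ +
      ∑ i, ∑ v with c v = c (σ i), φ (Function.update σ i v) := by
  by_cases hσ : G.IsFlagSimplex σ
  · rw [flagLaplacian_apply_of_isFlagSimplex hG hφ hσ,
      card_filter_forall_ne hc ((isFlagSimplex_iff_injective hG σ).1 hσ)]
    push_cast
    ring
  · have h1 : ∑ i, ∑ v with c v = c (σ i), φ (Function.update σ i v) = 0 := by
      refine Finset.sum_eq_zero fun i _ => Finset.sum_eq_zero fun v hv => hφ.1 _ ?_
      rw [isFlagSimplex_iff_injective hG] at hσ ⊢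
      rwa [comp_update_of_eq (Finset.mem_filter.1 hv).2]
    have h2 (v : V) : ¬ G.IsFlagSimplex (Fin.cons v σ : Fin (k + 2) → V) := by
      intro h
      refine hσ fun i j hij => ?_
      simpa using h i.succ j.succ (fun e => hij (Fin.succ_injective _ e))
    rw [h1, hφ.1 _ hσ]
    simp [flagLaplacian, coboundary, coboundaryAdj, hσ, h2]

/-- Summing over one part in a fixed coordinate is a positive semidefinite operator. -/
lemma sum_mul_sum_update_nonneg {k : ℕ} (φ : (Fin (k + 1) → V) → ℝ) (i : Fin (k + 1)) :
    0 ≤ ∑ σ, φ σ * ∑ v with c v = c (σ i), φ (Function.update σ i v) := by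
  rw [← (Fin.insertNthEquiv (fun _ => V) i).sum_comp, Fintype.sum_prod_type_right]
  refine Finset.sum_nonneg fun τ _ => ?_
  let g (w : V) : ℝ := φ (i.insertNth w τ)
  calc (0 : ℝ) ≤ ∑ q, (∑ w with c w = q, g w) * ∑ v with c v = q, g v :=
        Finset.sum_nonneg fun q _ => mul_self_nonneg _
    _ = ∑ q, ∑ w with c w = q, g w * ∑ v with c v = c w, g v := by
        refine Finset.sum_congr rfl fun q _ => ?_
        rw [Finset.sum_mul]
        refine Finset.sum_congr rfl fun w hw => ?_
        rw [(Finset.mem_filter.1 hw).2]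
    _ = ∑ w, g w * ∑ v with c v = c w, g v := Finset.sum_fiberwise _ _ _
    _ = _ := by simp [g, Fin.insertNthEquiv]

lemma le_of_flagLaplacian_eq_smul {ℓ : ℕ} (hG : ∀ v w, G.Adj v w ↔ c v ≠ c w)
    (hc : ∀ q, #{v : V | c v = q} = ℓ) {k : ℕ} {φ : (Fin (k + 1) → V) → ℝ}
    (hφ : G.IsFlagCochain φ) (h0 : φ ≠ 0) {μ : ℝ} (hμ : G.flagLaplacian φ = μ • φ) :
    ℓ * ((Fintype.card κ : ℝ) - k - 1) ≤ μ := by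
  set a : ℝ := ℓ * ((Fintype.card κ : ℝ) - k - 1) with ha
  have hpos : 0 < ∑ σ, φ σ * φ σ := by
    obtain ⟨σ, hσ⟩ := Function.ne_iff.1 h0
    exact Finset.sum_pos' (fun _ _ => mul_self_nonneg _)
      ⟨σ, Finset.mem_univ _, mul_self_pos.2 hσ⟩
  have key : (μ - a) * ∑ σ, φ σ * φ σ =
      ∑ i, ∑ σ, φ σ * ∑ v with c v = c (σ i), φ (Function.update σ i v) := by
    rw [Finset.sum_comm, Finset.mul_sum]
    refine Finset.sum_congr rfl fun σ _ => ?_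
    have h := congrFun hμ σ
    rw [flagLaplacian_apply hG hc hφ, Pi.smul_apply, smul_eq_mul, ← ha] at h
    rw [← Finset.mul_sum, ← sub_eq_iff_eq_add'.2 h.symm]
    ring
  have hnn : 0 ≤ (μ - a) * ∑ σ, φ σ * φ σ :=
    key ▸ Finset.sum_nonneg fun i _ => sum_mul_sum_update_nonneg φ i
  exact sub_nonneg.1 (nonneg_of_mul_nonneg_left hnn hpos)

/-- A complete multipartite graph with parts of size `ℓ ≥ 2` has a nonzero cochain on which the
Laplacian acts as a scalar: a join of functions on the parts with zero sum. -/
lemma exists_flagLaplacian_eq_smul {ℓ : ℕ} (hG : ∀ v w, G.Adj v w ↔ c v ≠ c w)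
    (hc : ∀ q, #{v : V | c v = q} = ℓ) (hℓ : 2 ≤ ℓ) {k : ℕ} (hk : k + 1 ≤ Fintype.card κ) :
    ∃ φ : (Fin (k + 1) → V) → ℝ, G.IsFlagCochain φ ∧ φ ≠ 0 ∧
      G.flagLaplacian φ = ((ℓ : ℝ) * ((Fintype.card κ : ℝ) - k - 1)) • φ := by
  classical
  obtain ⟨f, hf0, hf⟩ := exists_sum_eq_zero_and_ne_zero (c := c) fun q => (hc q).symm ▸ hℓ
  obtain ⟨s⟩ : Nonempty (Fin (k + 1) ↪ κ) :=
    Function.Embedding.nonempty_of_card_le (by simpa using hk)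
  let D (p : Fin (k + 1) → κ) : ℝ :=
    Matrix.det (Matrix.of fun i j => if p i = s j then (1 : ℝ) else 0)
  let φ (σ : Fin (k + 1) → V) : ℝ := (∏ i, f (σ i)) * D (c ∘ σ)
  have hφ : G.IsFlagCochain φ := by
    constructor
    · intro σ hσ
      rw [isFlagSimplex_iff_injective hG, Function.not_injective_iff] at hσ
      obtain ⟨i, j, hij, hne⟩ := hσ
      refine mul_eq_zero_of_right _ (Matrix.det_zero_of_row_eq hne ?_)
      ext t
      simp only [Matrix.of_apply, hij]
    · intro σ π
      have h1 : ∏ i, f ((σ ∘ π) i) = ∏ i, f (σ i) := Equiv.prod_comp π fun i => f (σ i)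
      have h2 : D (c ∘ σ ∘ π) = ((Equiv.Perm.sign π : ℤ) : ℝ) * D (c ∘ σ) :=
        Matrix.det_permute π (Matrix.of fun i j => if (c ∘ σ) i = s j then (1 : ℝ) else 0)
      simp only [φ, h1, h2]
      ring
  refine ⟨φ, hφ, ?_, ?_⟩
  · choose a ha hfa using hf
    refine Function.ne_iff.2 ⟨fun i => a (s i), mul_ne_zero ?_ ?_⟩
    · exact Finset.prod_ne_zero_iff.2 fun i _ => hfa _
    · have : (Matrix.of fun i j => if (c ∘ fun i => a (s i)) i = s j then (1 : ℝ) else 0) =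
          (1 : Matrix (Fin (k + 1)) (Fin (k + 1)) ℝ) := by
        ext i j
        simp [ha, Matrix.one_apply]
      simp only [D, this, Matrix.det_one, ne_eq, one_ne_zero, not_false_eq_true]
  · ext σ
    rw [flagLaplacian_apply hG hc hφ, Pi.smul_apply, smul_eq_mul, add_eq_left]
    refine Finset.sum_eq_zero fun i _ => ?_
    have h : ∀ v ∈ ({v | c v = c (σ i)} : Finset V), φ (Function.update σ i v) =
        f v * ((∏ j ∈ univ \ {i}, f (σ j)) * D (c ∘ σ)) := by
      intro v hv
      simp only [φ]
      rw [comp_update_of_eq (Finset.mem_filter.1 hv).2, ← mul_assoc]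
      congr 1
      have := Finset.prod_update_of_mem (Finset.mem_univ i) (fun j => f (σ j)) (f v)
      rw [← this]
      refine Finset.prod_congr rfl fun j _ => ?_
      exact Function.apply_update (fun _ => f) σ i v j
    rw [Finset.sum_congr rfl h, ← Finset.sum_mul, hf0, zero_mul]

/-- The minimal eigenvalue of the Laplacian of a complete multipartite graph all of whose parts
have size `ℓ ≥ 2`. -/
theorem flagMu_of_adj_iff_ne [DecidableEq V] {ℓ : ℕ} (hG : ∀ v w, G.Adj v w ↔ c v ≠ c w)
    (hc : ∀ q, #{v : V | c v = q} = ℓ) (hℓ : 2 ≤ ℓ) {k : ℕ} (hk : k + 1 ≤ Fintype.card κ) :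
    G.flagMu k = (ℓ : ℝ) * ((Fintype.card κ : ℝ) - k - 1) := by
  refine IsLeast.csInf_eq ⟨exists_flagLaplacian_eq_smul hG hc hℓ hk, ?_⟩
  rintro μ ⟨φ, hφ, h0, hμ⟩
  exact le_of_flagLaplacian_eq_smul hG hc hφ h0 hμ

end SimpleGraph

lemma card_filter_mod_eq (r ℓ : ℕ) (q : Fin r) :
    #{v : Fin (r * ℓ) | (v : ℕ) % r = q} = ℓ := by
  have hlt (t : Fin ℓ) : (q : ℕ) + r * t < r * ℓ := by
    have h1 := q.2
    have h2 : r * (t + 1) ≤ r * ℓ := Nat.mul_le_mul_left r t.2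
    rw [Nat.mul_add] at h2
    omega
  have hr : 0 < r := q.pos
  conv_rhs => rw [← Finset.card_fin ℓ]
  refine Eq.symm (Finset.card_bij (fun t _ => ⟨q + r * t, hlt t⟩) ?_ ?_ ?_)
  · intro t _
    simp [Nat.mod_eq_of_lt q.2]
  · intro t _ u _ h
    simpa [Fin.ext_iff, hr.ne'] using h
  · intro v hv
    refine ⟨⟨v / r, Nat.div_lt_of_lt_mul v.2⟩, Finset.mem_univ _, Fin.ext ?_⟩
    exact (congrArg (· + r * (v / r : ℕ)) (Finset.mem_filter.1 hv).2).symm.trans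
      (Nat.mod_add_div (v : ℕ) r)

/-- For the Turán graph `T_r(n)` with `n = r·ℓ` (`r ≥ 1`, `ℓ ≥ 2`), the complete `r`-partite
graph with all parts of size `ℓ`, the minimal eigenvalue of the reduced `k`-Laplacian of its
flag complex equals `μ_k(T_r(n)) = ℓ·(r − k − 1)` for all `0 ≤ k ≤ r − 1`. -/
theorem flagMu_turanGraph (r ℓ : ℕ) (hr : 1 ≤ r) (hℓ : 2 ≤ ℓ) (k : ℕ) (hk : k ≤ r - 1) :
    (SimpleGraph.turanGraph (r * ℓ) r).flagMu k = (ℓ : ℝ) * ((r : ℝ) - (k : ℝ) - 1) := by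
  have h := SimpleGraph.flagMu_of_adj_iff_ne (G := SimpleGraph.turanGraph (r * ℓ) r)
    (c := fun v => (⟨v % r, Nat.mod_lt _ hr⟩ : Fin r)) (ℓ := ℓ) (k := k)
    (fun v w => by simp [SimpleGraph.turanGraph_adj])
    (fun q => by simpa [Fin.ext_iff] using card_filter_mod_eq r ℓ q) hℓ
    (by rw [Fintype.card_fin]; omega)
  rwa [Fintype.card_fin] at h
end

section
/- Let P be a vector representation of a finite simple graph G=(V,E) on n vertices. Then the largest Laplacian eigenvalue satisfies λ_n(G) ≤ max_{u∈V} P(u) · Σ_{v∈V} P(v). -/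
open Finset
open scoped ENNReal
/-- `λ_n(G)`, the largest Laplacian eigenvalue. -/
noncomputable def SimpleGraph.lambdaMax {V : Type*} [Fintype V] [DecidableEq V]
    (G : SimpleGraph V) : ℝ :=
  G.sortedLapEigenvalues.getD (Fintype.card V - 1) 0
/-- A vector representation of `G`: an assignment of vectors to the vertices with
`P(u)·P(v) ≥ 1` for adjacent `u, v` and `P(u)·P(v) ≥ 0` for non-adjacent `u, v`. -/
def SimpleGraph.IsVectorRep {V : Type*} (G : SimpleGraph V) {ι : Type*} [Fintype ι]
    (P : V → ι → ℝ) : Prop :=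
  (∀ u v : V, G.Adj u v → 1 ≤ ∑ i, P u i * P v i) ∧
  (∀ u v : V, ¬ G.Adj u v → 0 ≤ ∑ i, P u i * P v i)
lemma SimpleGraph.IsVectorRep.sum_adj_le {V ι : Type*} [Fintype V] [DecidableEq V] [Fintype ι]
    {G : SimpleGraph V} [DecidableRel G.Adj] {P : V → ι → ℝ} (hP : G.IsVectorRep P) (x : V → ℝ) :
    (∑ u, ∑ v, if G.Adj u v then (x u - x v) ^ 2 else 0) ≤
      ∑ u, ∑ v, (∑ i, P u i * P v i) * (x u - x v) ^ 2 := by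
  gcongr with u _ v _
  split_ifs with h
  · exact le_mul_of_one_le_left (sq_nonneg _) (hP.1 u v h)
  · exact mul_nonneg (hP.2 u v h) (sq_nonneg _)

/-- The Laplacian quadratic form weighted by a Gram matrix, expanded. -/
lemma sum_gram_mul_sub_sq {V ι : Type*} [Fintype V] [Fintype ι] (P : V → ι → ℝ) (x : V → ℝ) :
    ∑ u, ∑ v, (∑ i, P u i * P v i) * (x u - x v) ^ 2 =
      2 * ∑ u, (∑ i, P u i * ∑ v, P v i) * x u ^ 2 - 2 * ∑ i, (∑ u, x u * P u i) ^ 2 := by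
  have hdiag : ∑ u, (∑ i, P u i * ∑ v, P v i) * x u ^ 2 =
      ∑ u, ∑ v, (∑ i, P u i * P v i) * x u ^ 2 := by
    refine sum_congr rfl fun u _ => ?_
    rw [← sum_mul, sum_comm]
    simp only [mul_sum]
  have hdiag' : ∑ u, ∑ v, (∑ i, P u i * P v i) * x u ^ 2 =
      ∑ u, ∑ v, (∑ i, P u i * P v i) * x v ^ 2 := by
    rw [sum_comm]
    exact sum_congr rfl fun u _ => sum_congr rfl fun v _ => by simp only [mul_comm (P v _)]
  have hsq : ∑ i, (∑ u, x u * P u i) ^ 2 =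
      ∑ u, ∑ v, (∑ i, P u i * P v i) * (x u * x v) := by
    simp only [sq, Finset.sum_mul_sum, Finset.sum_mul _ _ (_ * _)]
    rw [sum_comm]
    refine sum_congr rfl fun u _ => ?_
    rw [sum_comm]
    exact sum_congr rfl fun v _ => sum_congr rfl fun i _ => by ring
  rw [hdiag, hsq, two_mul]
  nth_rewrite 2 [hdiag']
  simp only [mul_sum univ _ (2 : ℝ), ← sum_add_distrib, ← sum_sub_distrib]
  exact sum_congr rfl fun u _ => sum_congr rfl fun v _ => by ring

open Matrix in
lemma SimpleGraph.IsVectorRep.dotProduct_lapMatrix_mulVec_le {V ι : Type*} [Fintype V]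
    [DecidableEq V] [Fintype ι] {G : SimpleGraph V} [DecidableRel G.Adj] {P : V → ι → ℝ}
    (hP : G.IsVectorRep P) {M : ℝ} (hM : ∀ u, ∑ i, P u i * ∑ v, P v i ≤ M) (x : V → ℝ) :
    x ⬝ᵥ G.lapMatrix ℝ *ᵥ x ≤ M * (x ⬝ᵥ x) := by
  have hL := G.lapMatrix_toLinearMap₂' ℝ x
  rw [Matrix.toLinearMap₂'_apply'] at hL
  rw [hL]
  have hdiag : ∑ u, (∑ i, P u i * ∑ v, P v i) * x u ^ 2 ≤ M * (x ⬝ᵥ x) := by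
    rw [dotProduct, mul_sum]
    refine sum_le_sum fun u _ => ?_
    rw [← sq]
    exact mul_le_mul_of_nonneg_right (hM u) (sq_nonneg _)
  have hsq : 0 ≤ ∑ i, (∑ u, x u * P u i) ^ 2 := sum_nonneg fun i _ => sq_nonneg _
  linarith [hP.sum_adj_le x, sum_gram_mul_sub_sq P x]

open Matrix in
/-- An upper bound on the quadratic form of a real symmetric matrix bounds its eigenvalues. -/
lemma Matrix.IsHermitian.eigenvalues_le_of_dotProduct_le {n : Type*} [Fintype n] [DecidableEq n]
    {A : Matrix n n ℝ} (hA : A.IsHermitian) {M : ℝ}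
    (h : ∀ x : n → ℝ, x ⬝ᵥ A *ᵥ x ≤ M * (x ⬝ᵥ x)) (j : n) : hA.eigenvalues j ≤ M := by
  have hx := h (hA.eigenvectorBasis j)
  rw [hA.mulVec_eigenvectorBasis, dotProduct_smul, smul_eq_mul] at hx
  refine le_of_mul_le_mul_right hx ?_
  have hne : (hA.eigenvectorBasis j : n → ℝ) ≠ 0 := fun h0 =>
    hA.eigenvectorBasis.orthonormal.ne_zero j (by ext i; exact congrFun h0 i)
  simpa using dotProduct_star_self_pos_iff.mpr hne

open scoped Classical in
lemma SimpleGraph.exists_eigenvalues_eq_lambdaMax {V : Type*} [Fintype V] [DecidableEq V]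
    [Nonempty V] (G : SimpleGraph V) :
    ∃ j, (SimpleGraph.posSemidef_lapMatrix ℝ G).isHermitian.eigenvalues j = G.lambdaMax := by
  have hlt : Fintype.card V - 1 < G.sortedLapEigenvalues.length := by
    simp [SimpleGraph.sortedLapEigenvalues, List.length_insertionSort, Fintype.card_pos]
  have hmem : G.lambdaMax ∈ G.sortedLapEigenvalues := by
    rw [SimpleGraph.lambdaMax, List.getD_eq_getElem _ _ hlt]
    exact List.getElem_mem hlt
  rw [SimpleGraph.sortedLapEigenvalues, List.mem_insertionSort, List.mem_ofFn] at hmem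
  obtain ⟨k, hk⟩ := hmem
  refine ⟨Fintype.equivOfCardEq (Fintype.card_fin _) k, ?_⟩
  rw [← hk, Matrix.IsHermitian.eigenvalues, Equiv.symm_apply_apply]

/-- **Claim 4.2**: for any vector representation `P` of a graph `G` (on a nonempty vertex
set), the largest Laplacian eigenvalue satisfies `λ_n(G) ≤ max_{u∈V} P(u)·∑_{v∈V} P(v)`. -/
theorem lambdaMax_le_of_isVectorRep {V : Type*} [Fintype V] [DecidableEq V] [Nonempty V]
    (G : SimpleGraph V) (ℓ : ℕ) (P : V → Fin ℓ → ℝ) (hP : G.IsVectorRep P) :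
    G.lambdaMax ≤
      Finset.univ.sup' Finset.univ_nonempty (fun u : V => ∑ i, P u i * ∑ v : V, P v i) := by
  classical
  obtain ⟨j, hj⟩ := G.exists_eigenvalues_eq_lambdaMax
  rw [← hj]
  refine Matrix.IsHermitian.eigenvalues_le_of_dotProduct_le _ (fun x => ?_) j
  exact hP.dotProduct_lapMatrix_mulVec_le
    (fun u => le_sup' (fun u : V => ∑ i, P u i * ∑ v : V, P v i) (mem_univ u)) x
end

section
/- Let P be a vector representation of a finite simple graph G=(V,E). Then for every vector x ∈ ℝ^V, Σ_{uv∈E} (x(u)−x(v))² ≤ (1/2) Σ_{(u,v)∈V×V} (x(u)−x(v))² P(u)·P(v) = Σ_{u∈V} x(u)² (P(u) · Σ_{v∈V} P(v)) − ‖Σ_{v∈V} x(v)P(v)‖². -/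
open Finset
open scoped ENNReal
/-- Summing a function of the edge over all ordered pairs of adjacent vertices counts every edge
twice. -/
theorem SimpleGraph.sum_sum_adj_eq_two_nsmul_sum_edgeFinset {V M : Type*} [Fintype V]
    [DecidableEq V] [AddCommMonoid M] (G : SimpleGraph V) [DecidableRel G.Adj] (f : Sym2 V → M) :
    (∑ u : V, ∑ v : V, if G.Adj u v then f s(u, v) else 0) = 2 • ∑ e ∈ G.edgeFinset, f e := by
  have hdart : (∑ u : V, ∑ v : V, if G.Adj u v then f s(u, v) else 0) =
      ∑ d : G.Dart, f d.edge := by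
    rw [← Fintype.sum_prod_type' (f := fun u v => if G.Adj u v then f s(u, v) else 0),
      ← Finset.sum_filter]
    exact Finset.sum_bij' (fun p hp => ⟨p, (Finset.mem_filter.1 hp).2⟩) (fun d _ => d.toProd)
      (by simp) (by simp) (by simp) (by simp) (fun _ _ => rfl)
  rw [hdart, ← Finset.sum_fiberwise_of_maps_to (g := SimpleGraph.Dart.edge) (t := G.edgeFinset)
    (fun d _ => SimpleGraph.mem_edgeFinset.2 d.edge_mem), Finset.smul_sum]
  refine Finset.sum_congr rfl fun e he => ?_
  rw [Finset.sum_congr rfl fun d hd => congrArg f (Finset.mem_filter.1 hd).2, Finset.sum_const,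
    G.dart_edge_fiber_card e (SimpleGraph.mem_edgeFinset.1 he)]

/-- The quadratic form of the weighted Laplacian of a symmetric weight function. -/
theorem half_sum_sub_sq_mul_of_symm {V : Type*} [Fintype V] (M : V → V → ℝ)
    (hM : ∀ u v, M u v = M v u) (x : V → ℝ) :
    (1 / 2) * (∑ u : V, ∑ v : V, (x u - x v) ^ 2 * M u v) =
      (∑ u : V, x u ^ 2 * ∑ v : V, M u v) - ∑ u : V, ∑ v : V, x u * x v * M u v := by
  have hswap : ∑ u : V, ∑ v : V, x v ^ 2 * M u v = ∑ u : V, ∑ v : V, x u ^ 2 * M u v := by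
    rw [Finset.sum_comm]
    simp only [hM]
  have hexpand : ∀ u v, (x u - x v) ^ 2 * M u v =
      x u ^ 2 * M u v + x v ^ 2 * M u v - 2 * (x u * x v * M u v) := fun u v => by ring
  simp only [hexpand, Finset.sum_sub_distrib, Finset.sum_add_distrib, hswap, ← Finset.mul_sum]
  ring

/-- The squared norm of a linear combination, expanded through the Gram matrix. -/
theorem sum_sq_sum_mul_eq_sum_gram {V ι : Type*} [Fintype V] [Fintype ι] (P : V → ι → ℝ)
    (x : V → ℝ) :
    ∑ i, (∑ v : V, x v * P v i) ^ 2 = ∑ u : V, ∑ v : V, x u * x v * ∑ i, P u i * P v i := by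
  simp only [sq, Finset.sum_mul_sum]
  simp only [Finset.mul_sum]
  rw [Finset.sum_comm]
  refine Finset.sum_congr rfl fun u _ => ?_
  rw [Finset.sum_comm]
  exact Finset.sum_congr rfl fun v _ => Finset.sum_congr rfl fun i _ => by ring

/-- The key estimate in Claim 4.2: for a vector representation `P` of `G` and any `x : V → ℝ`,
`∑_{uv∈E} (x(u)−x(v))² ≤ (1/2)·∑_{(u,v)∈V×V} (x(u)−x(v))²·P(u)·P(v)`, and the latter equals
`∑_u x(u)²·(P(u)·∑_v P(v)) − ‖∑_v x(v)P(v)‖²`. -/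
theorem sum_edges_sq_le_of_isVectorRep {V : Type*} [Fintype V] [DecidableEq V]
    (G : SimpleGraph V) [DecidableRel G.Adj] (ℓ : ℕ) (P : V → Fin ℓ → ℝ)
    (hP : G.IsVectorRep P) (x : V → ℝ) :
    (∑ e ∈ G.edgeFinset,
        Sym2.lift ⟨fun u v => (x u - x v) ^ 2, fun _ _ => by ring⟩ e) ≤
      (1 / 2) * ∑ u : V, ∑ v : V, (x u - x v) ^ 2 * ∑ i, P u i * P v i ∧
    (1 / 2) * (∑ u : V, ∑ v : V, (x u - x v) ^ 2 * ∑ i, P u i * P v i) =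
      (∑ u : V, x u ^ 2 * ∑ i, P u i * ∑ v : V, P v i) -
        ∑ i, (∑ v : V, x v * P v i) ^ 2 := by
  constructor
  · have hedge := G.sum_sum_adj_eq_two_nsmul_sum_edgeFinset
      (Sym2.lift ⟨fun u v => (x u - x v) ^ 2, fun _ _ => by ring⟩)
    have hle : (∑ u : V, ∑ v : V, if G.Adj u v then (x u - x v) ^ 2 else 0) ≤
        ∑ u : V, ∑ v : V, (x u - x v) ^ 2 * ∑ i, P u i * P v i := by
      refine Finset.sum_le_sum fun u _ => Finset.sum_le_sum fun v _ => ?_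
      split_ifs with h
      · exact le_mul_of_one_le_right (sq_nonneg _) (hP.1 u v h)
      · exact mul_nonneg (sq_nonneg _) (hP.2 u v h)
    simp only [Sym2.lift_mk, nsmul_eq_mul, Nat.cast_ofNat] at hedge
    linarith
  · rw [half_sum_sub_sq_mul_of_symm _ (fun u v => by simp only [mul_comm]) x,
      sum_sq_sum_mul_eq_sum_gram]
    congr 1
    refine Finset.sum_congr rfl fun u _ => ?_
    simp only [Finset.mul_sum]
    rw [Finset.sum_comm]
end

section
/- Let X=X(G) be the flag complex of a finite simple graph G and let k ≥ 0. For every k-cochain φ ∈ C^k(X), ‖d_k φ‖² = Σ_{σ∈X(k)} deg(σ) φ(σ)² − 2 Σ_{η∈X(k−1)} Σ_{vw∈lk(η)} φ(vη) φ(wη), where the inner sum runs over edges vw of the link of η. -/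
open Finset
open scoped ENNReal
/-- The squared norm of a cochain with respect to the standard inner product: summing
`φ(σ)^2` over the simplices `σ` with a fixed chosen orientation amounts to summing over
all ordered tuples and dividing by the number `m!` of orderings. -/
noncomputable def cochainNormSq {V : Type*} [Fintype V] [DecidableEq V] {m : ℕ}
    (φ : (Fin m → V) → ℝ) : ℝ :=
  ((Nat.factorial m : ℝ))⁻¹ * ∑ σ : Fin m → V, φ σ ^ 2
open scoped Classical in
/-- The degree of a simplex `σ` of `X(G)`: the number of simplices of one higher dimension
containing it, i.e. the number of common neighbours of its vertices. -/
noncomputable def SimpleGraph.simplexDeg {V : Type*} [Fintype V] (G : SimpleGraph V) {m : ℕ}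
    (σ : Fin m → V) : ℕ :=
  (Finset.univ.filter fun u : V => G.IsFlagSimplex (Fin.cons u σ)).card
open scoped Classical in
/-- `∑_{η ∈ X(m-1)} ∑_{vw ∈ lk(η)} φ(vη)·φ(wη)`: the sum over (unoriented) simplices `η` and
over (unordered) edges `vw` of the link of `η`; ordered tuples `η` overcount by `m!` and
ordered pairs `(v, w)` overcount each edge of the link twice, whence the normalisation. -/
noncomputable def SimpleGraph.linkEdgeSum {V : Type*} [Fintype V] [DecidableEq V]
    (G : SimpleGraph V) {m : ℕ} (φ : (Fin (m + 1) → V) → ℝ) : ℝ :=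
  ((Nat.factorial m : ℝ))⁻¹ * (1 / 2) * ∑ η : Fin m → V, ∑ v : V, ∑ w : V,
    if G.IsFlagSimplex (Fin.cons v (Fin.cons w η)) then φ (Fin.cons v η) * φ (Fin.cons w η)
    else 0

theorem SimpleGraph.isFlagSimplex_comp_perm_s8 {V : Type*} (G : SimpleGraph V) {m : ℕ}
    (σ : Fin m → V) (π : Equiv.Perm (Fin m)) :
    G.IsFlagSimplex (σ ∘ π) ↔ G.IsFlagSimplex σ := by
  refine ⟨fun h i j hij => ?_, fun h i j hij => h _ _ (π.injective.ne hij)⟩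
  simpa using h (π.symm i) (π.symm j) (π.symm.injective.ne hij)

/-- A face of an ordered tuple may be computed, up to sign, by first moving the deleted entry
to the front by any permutation. -/
theorem SimpleGraph.IsFlagCochain.sign_mul_succAbove {V : Type*} {G : SimpleGraph V} {m : ℕ}
    {φ : (Fin m → V) → ℝ} (hφ : G.IsFlagCochain φ) (σ : Fin (m + 1) → V)
    (ρ : Equiv.Perm (Fin (m + 1))) :
    (-1 : ℝ) ^ (ρ 0 : ℕ) * φ (σ ∘ (ρ 0).succAbove) =
      ((Equiv.Perm.sign ρ : ℤ) : ℝ) * φ (σ ∘ ρ ∘ Fin.succ) := by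
  set c : Equiv.Perm (Fin (m + 1)) := (ρ 0).cycleRange with hc
  obtain ⟨⟨p, π⟩, hπ⟩ := Equiv.Perm.decomposeFin.symm.surjective (c * ρ)
  have hp : p = 0 := by
    have h := congrArg (fun e : Equiv.Perm (Fin (m + 1)) => e 0) hπ
    simpa [hc] using h
  subst hp
  have hρ : ρ = c⁻¹ * Equiv.Perm.decomposeFin.symm (0, π) := by rw [hπ]; group
  have hsign : ((Equiv.Perm.sign ρ : ℤ) : ℝ) =
      (-1 : ℝ) ^ (ρ 0 : ℕ) * ((Equiv.Perm.sign π : ℤ) : ℝ) := by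
    conv_lhs => rw [hρ]
    simp [hc, Fin.sign_cycleRange]
  have hface : σ ∘ ρ ∘ Fin.succ = (σ ∘ (ρ 0).succAbove) ∘ π := by
    funext x
    have hx : ρ x.succ = c.symm (π x).succ := by
      conv_lhs => rw [hρ]
      simp [Equiv.Perm.inv_def]
    simp [hx, hc, Fin.cycleRange_symm_succ]
  rw [hsign, hface, hφ.2]
  have hsq : ((Equiv.Perm.sign π : ℤ) : ℝ) * ((Equiv.Perm.sign π : ℤ) : ℝ) = 1 := by
    exact_mod_cast Int.units_coe_mul_self (Equiv.Perm.sign π)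
  linear_combination (-(-1 : ℝ) ^ (ρ 0 : ℕ) * φ (σ ∘ (ρ 0).succAbove)) * hsq

theorem Fin.sum_pi_cons {V M : Type*} [Fintype V] [AddCommMonoid M] {n : ℕ}
    (f : (Fin (n + 1) → V) → M) :
    ∑ σ, f σ = ∑ τ : Fin n → V, ∑ v : V, f (Fin.cons v τ) := by
  rw [← (Fin.consEquiv fun _ : Fin (n + 1) => V).sum_comp, Fintype.sum_prod_type_right]
  rfl

open scoped Classical in
/-- The contribution of the square of each face to `‖dφ‖²`. -/
theorem SimpleGraph.IsFlagCochain.sum_face_sq {V : Type*} [Fintype V] [DecidableEq V]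
    {G : SimpleGraph V} {m : ℕ} {φ : (Fin m → V) → ℝ} (hφ : G.IsFlagCochain φ)
    (i : Fin (m + 1)) :
    (∑ σ : Fin (m + 1) → V, if G.IsFlagSimplex σ then
      ((-1 : ℝ) ^ (i : ℕ) * φ (σ ∘ i.succAbove)) *
        ((-1 : ℝ) ^ (i : ℕ) * φ (σ ∘ i.succAbove)) else 0) =
      ∑ τ : Fin m → V, (G.simplexDeg τ : ℝ) * φ τ ^ 2 := by
  set ρ : Equiv.Perm (Fin (m + 1)) := Equiv.swap 0 i
  have h0 : ρ 0 = i := Equiv.swap_apply_left 0 i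
  have hsq : ((Equiv.Perm.sign ρ : ℤ) : ℝ) * ((Equiv.Perm.sign ρ : ℤ) : ℝ) = 1 := by
    exact_mod_cast Int.units_coe_mul_self (Equiv.Perm.sign ρ)
  calc _ = ∑ σ : Fin (m + 1) → V, if G.IsFlagSimplex (σ ∘ ρ) then
          φ ((σ ∘ ρ) ∘ Fin.succ) ^ 2 else 0 := by
        refine Finset.sum_congr rfl fun σ _ => ?_
        have h := hφ.sign_mul_succAbove σ ρ
        rw [h0] at h
        rw [h, G.isFlagSimplex_comp_perm_s8, Function.comp_assoc]
        congr 1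
        linear_combination φ (σ ∘ ρ ∘ Fin.succ) ^ 2 * hsq
    _ = ∑ σ : Fin (m + 1) → V, if G.IsFlagSimplex σ then φ (σ ∘ Fin.succ) ^ 2 else 0 :=
        (Equiv.arrowCongr ρ.symm (Equiv.refl V)).sum_comp
          fun σ => if G.IsFlagSimplex σ then φ (σ ∘ Fin.succ) ^ 2 else 0
    _ = _ := by
        rw [Fin.sum_pi_cons]
        refine Finset.sum_congr rfl fun τ _ => ?_
        have h (v : V) : (Fin.cons v τ : Fin (m + 1) → V) ∘ Fin.succ = τ := rfl
        simp only [h]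
        rw [← Finset.sum_filter, Finset.sum_const, nsmul_eq_mul, SimpleGraph.simplexDeg]

open scoped Classical in
/-- The contribution of each pair of distinct faces to `‖dφ‖²`. -/
theorem SimpleGraph.IsFlagCochain.sum_face_mul_face {V : Type*} [Fintype V] [DecidableEq V]
    {G : SimpleGraph V} {k : ℕ} {φ : (Fin (k + 1) → V) → ℝ} (hφ : G.IsFlagCochain φ)
    {i j : Fin (k + 2)} (hij : i ≠ j) :
    (∑ σ : Fin (k + 2) → V, if G.IsFlagSimplex σ then
      ((-1 : ℝ) ^ (i : ℕ) * φ (σ ∘ i.succAbove)) *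
        ((-1 : ℝ) ^ (j : ℕ) * φ (σ ∘ j.succAbove)) else 0) =
      -∑ η : Fin k → V, ∑ v : V, ∑ w : V,
        if G.IsFlagSimplex (Fin.cons v (Fin.cons w η)) then
          φ (Fin.cons v η) * φ (Fin.cons w η) else 0 := by
  set s : Equiv.Perm (Fin (k + 2)) := Equiv.swap 0 1 with hs
  obtain ⟨ρ, h0, h1⟩ : ∃ ρ : Equiv.Perm (Fin (k + 2)), ρ 0 = i ∧ ρ 1 = j := by
    refine ⟨Equiv.swap 0 i * Equiv.swap 1 (Equiv.swap 0 i j), ?_, by simp⟩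
    have hj : (0 : Fin (k + 2)) ≠ Equiv.swap 0 i j := by
      intro h
      have h' := congrArg (Equiv.swap 0 i) h
      simp at h'
      exact hij h'
    rw [Equiv.Perm.mul_apply, Equiv.swap_apply_of_ne_of_ne (by simp) hj,
      Equiv.swap_apply_left]
  have hsq : ((Equiv.Perm.sign ρ : ℤ) : ℝ) * ((Equiv.Perm.sign ρ : ℤ) : ℝ) = 1 := by
    exact_mod_cast Int.units_coe_mul_self (Equiv.Perm.sign ρ)
  let F : (Fin (k + 2) → V) → ℝ := fun σ =>
    if G.IsFlagSimplex σ then -(φ (σ ∘ s ∘ Fin.succ) * φ (σ ∘ Fin.succ)) else 0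
  calc _ = ∑ σ : Fin (k + 2) → V, F (σ ∘ ρ) := by
        refine Finset.sum_congr rfl fun σ _ => ?_
        have hi := hφ.sign_mul_succAbove σ ρ
        have hj := hφ.sign_mul_succAbove σ (ρ * s)
        have hs0 : (ρ * s) 0 = j := by simp [hs, h1]
        have hsgn : ((Equiv.Perm.sign (ρ * s) : ℤ) : ℝ) = -((Equiv.Perm.sign ρ : ℤ) : ℝ) := by
          simp [hs]
        rw [h0] at hi
        rw [hs0, hsgn, Equiv.Perm.coe_mul, Function.comp_assoc] at hj
        simp only [F]
        rw [hi, hj, G.isFlagSimplex_comp_perm_s8, Function.comp_assoc, Function.comp_assoc]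
        congr 1
        linear_combination
          (-φ (σ ∘ ρ ∘ Fin.succ) * φ (σ ∘ ρ ∘ s ∘ Fin.succ)) * hsq
    _ = ∑ σ, F σ := (Equiv.arrowCongr ρ.symm (Equiv.refl V)).sum_comp F
    _ = _ := by
        rw [Fin.sum_pi_cons, Fin.sum_pi_cons, ← Finset.sum_neg_distrib]
        refine Finset.sum_congr rfl fun η _ => ?_
        rw [Finset.sum_comm, ← Finset.sum_neg_distrib]
        refine Finset.sum_congr rfl fun v _ => ?_
        rw [← Finset.sum_neg_distrib]
        refine Finset.sum_congr rfl fun w _ => ?_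
        have hw : (Fin.cons v (Fin.cons w η : Fin (k + 1) → V) : Fin (k + 2) → V) ∘ Fin.succ =
            Fin.cons w η := rfl
        have hv : (Fin.cons v (Fin.cons w η : Fin (k + 1) → V) : Fin (k + 2) → V) ∘
            s ∘ Fin.succ = Fin.cons v η := by
          funext x
          refine Fin.cases ?_ (fun y => ?_) x
          · simp [hs]
          · have hy : s y.succ.succ = y.succ.succ :=
              Equiv.swap_apply_of_ne_of_ne (Fin.succ_ne_zero _)
                (fun h => Fin.succ_ne_zero y (Fin.succ_injective _ h))
            simp [hy]
        simp only [F, hw, hv]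
        split_ifs <;> simp

/-- **Claim 3.1**: for a `k`-cochain `φ` of the flag complex `X(G)`,
`‖d_k φ‖² = ∑_{σ∈X(k)} deg(σ)·φ(σ)² − 2·∑_{η∈X(k-1)} ∑_{vw∈lk(η)} φ(vη)·φ(wη)`
(sums over unoriented simplices are realised as sums over ordered tuples divided by the
number of orderings). -/
theorem normSq_coboundary {V : Type*} [Fintype V] [DecidableEq V] (G : SimpleGraph V)
    (k : ℕ) (φ : (Fin (k + 1) → V) → ℝ) (hφ : G.IsFlagCochain φ) :
    cochainNormSq (G.coboundary φ) =
      ((Nat.factorial (k + 1) : ℝ))⁻¹ *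
          (∑ σ : Fin (k + 1) → V, (G.simplexDeg σ : ℝ) * φ σ ^ 2) -
        2 * G.linkEdgeSum φ := by
  classical
  set D := ∑ σ : Fin (k + 1) → V, (G.simplexDeg σ : ℝ) * φ σ ^ 2
  set L := ∑ η : Fin k → V, ∑ v : V, ∑ w : V,
    if G.IsFlagSimplex (Fin.cons v (Fin.cons w η)) then
      φ (Fin.cons v η) * φ (Fin.cons w η) else 0 with hL
  have hsum : ∑ σ : Fin (k + 2) → V, G.coboundary φ σ ^ 2 =
      ((k : ℝ) + 2) * (D - ((k : ℝ) + 1) * L) := by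
    calc _ = ∑ σ : Fin (k + 2) → V, ∑ i : Fin (k + 2), ∑ j : Fin (k + 2),
          if G.IsFlagSimplex σ then ((-1 : ℝ) ^ (i : ℕ) * φ (σ ∘ i.succAbove)) *
            ((-1 : ℝ) ^ (j : ℕ) * φ (σ ∘ j.succAbove)) else 0 := by
          refine Finset.sum_congr rfl fun σ _ => ?_
          by_cases h : G.IsFlagSimplex σ
          · simp only [SimpleGraph.coboundary, h, if_true]
            rw [sq, Finset.sum_mul_sum]
          · simp [SimpleGraph.coboundary, h]
      _ = ∑ i : Fin (k + 2), ∑ j : Fin (k + 2), if i = j then D else -L := by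
          rw [Finset.sum_comm]
          refine Finset.sum_congr rfl fun i _ => ?_
          rw [Finset.sum_comm]
          refine Finset.sum_congr rfl fun j _ => ?_
          split_ifs with hij
          · subst hij
            exact hφ.sum_face_sq i
          · exact hφ.sum_face_mul_face hij
      _ = ∑ i : Fin (k + 2), ∑ j : Fin (k + 2), ((if i = j then D + L else 0) - L) := by
          refine Finset.sum_congr rfl fun i _ => Finset.sum_congr rfl fun j _ => ?_
          split_ifs <;> ring
      _ = _ := by
          simp [Finset.sum_sub_distrib]
          ring
  have hlink : G.linkEdgeSum φ = ((Nat.factorial k : ℝ))⁻¹ * (1 / 2) * L := by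
    simp only [SimpleGraph.linkEdgeSum, hL]
  rw [cochainNormSq, hsum, hlink]
  have hk : (Nat.factorial k : ℝ) ≠ 0 := by positivity
  have hk1 : (k : ℝ) + 1 ≠ 0 := by positivity
  have hk2 : (k : ℝ) + 2 ≠ 0 := by positivity
  have hf : (Nat.factorial (k + 1) : ℝ) = ((k : ℝ) + 1) * Nat.factorial k := by
    push_cast [Nat.factorial_succ]
    ring
  have hf' : (Nat.factorial (k + 1 + 1) : ℝ) =
      ((k : ℝ) + 2) * (((k : ℝ) + 1) * Nat.factorial k) := by
    rw [Nat.factorial_succ, Nat.cast_mul, hf]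
    push_cast
    ring
  rw [hf', hf]
  field_simp
end
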